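/- Suppose κ ≤ λ < μ are cardinals, κ is <λ-strong and λ is μ-strong. Then κ is μ-strong. Moreover, if A is a set such that κ is <λ-strong for A and λ is μ-strong for A, then κ is μ-strong for A. -/

import Mathlib

/-!
A framework for formalizing large-cardinal notions from
"Woodin for strong compactness cardinals" over the Mathlib model `ZFSet`
of ZFC.  The ambient set-theoretic universe `V` is the type `ZFSet`;
classes are sets `Set ZFSet`; everything is relativised to a "universe
class" `W : Set ZFSet` (the ambient universe being `W = Set.univ`), so
that the same definitions can also be interpreted inside transitive set
models of ZFC (used to express the forcing/consistency results).
-/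

namespace WSC

/-! ### First-order formulas in the language of set theory -/

/-- First-order formulas in the language `{∈}`, with `n` free (de Bruijn) variables. -/
inductive Fml : ℕ → Type where
  | mem {n} : Fin n → Fin n → Fml n
  | eq  {n} : Fin n → Fin n → Fml n
  | not {n} : Fml n → Fml n
  | and {n} : Fml n → Fml n → Fml n
  | ex  {n} : Fml (n + 1) → Fml n

namespace Fml

/-- Realization of a formula over the class `C`, with all quantifiers relativised to `C`. -/
def Realize (C : Set ZFSet) : ∀ {n}, Fml n → (Fin n → ZFSet) → Prop
  | _, .mem i j, v => v i ∈ v j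
  | _, .eq i j, v => v i = v j
  | _, .not φ, v => ¬ Realize C φ v
  | _, .and φ ψ, v => Realize C φ v ∧ Realize C ψ v
  | _, .ex φ, v => ∃ x ∈ C, Realize C φ (Fin.snoc v x)

def or {n} (φ ψ : Fml n) : Fml n := .not (.and (.not φ) (.not ψ))
def imp {n} (φ ψ : Fml n) : Fml n := Fml.or (.not φ) ψ
def iff {n} (φ ψ : Fml n) : Fml n := .and (imp φ ψ) (imp ψ φ)
def all {n} (φ : Fml (n + 1)) : Fml n := .not (.ex (.not φ))

/-- Universal closure. -/
def alls : ∀ {n}, Fml n → Fml 0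
  | 0, φ => φ
  | _ + 1, φ => alls (all φ)

/-- Renaming of variables. -/
def rename : ∀ {n m}, (Fin n → Fin m) → Fml n → Fml m
  | _, _, f, .mem i j => .mem (f i) (f j)
  | _, _, f, .eq i j => .eq (f i) (f j)
  | _, _, f, .not φ => .not (rename f φ)
  | _, _, f, .and φ ψ => .and (rename f φ) (rename f ψ)
  | _, _, f, .ex φ => .ex (rename (Fin.snoc (fun i => (f i).castSucc) (Fin.last _)) φ)

end Fml

/-- A sentence `φ` holds in the class `C`. -/
def Sat (C : Set ZFSet) (φ : Fml 0) : Prop := Fml.Realize C φ (fun i => i.elim0)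

/-! ### The ZFC axioms -/

def extAx : Fml 0 :=
  Fml.all (Fml.all (Fml.imp (Fml.all (Fml.iff (.mem 2 0) (.mem 2 1))) (.eq 0 1)))

def pairAx : Fml 0 := Fml.all (Fml.all (Fml.ex (Fml.and (.mem 0 2) (.mem 1 2))))

def unionAx : Fml 0 :=
  Fml.all (Fml.ex (Fml.all (Fml.all
    (Fml.imp (Fml.and (.mem 2 3) (.mem 3 0)) (.mem 2 1)))))

def powerAx : Fml 0 :=
  Fml.all (Fml.ex (Fml.all
    (Fml.imp (Fml.all (Fml.imp (.mem 3 2) (.mem 3 0))) (.mem 2 1))))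

def infAx : Fml 0 :=
  Fml.ex (Fml.and
    (Fml.ex (Fml.and (.mem 1 0) (Fml.all (Fml.not (.mem 2 1)))))
    (Fml.all (Fml.imp (.mem 1 0)
      (Fml.ex (Fml.and (.mem 2 0)
        (Fml.all (Fml.iff (.mem 3 2) (Fml.or (.mem 3 1) (.eq 3 1)))))))))

def foundAx : Fml 0 :=
  Fml.all (Fml.imp (Fml.ex (.mem 1 0))
    (Fml.ex (Fml.and (.mem 1 0) (Fml.all (Fml.imp (.mem 2 1) (Fml.not (.mem 2 0)))))))

def choiceAx : Fml 0 :=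
  Fml.all (Fml.imp
    (Fml.and
      (Fml.all (Fml.imp (.mem 1 0) (Fml.ex (.mem 2 1))))
      (Fml.all (Fml.all (Fml.imp
        (Fml.and (.mem 1 0) (Fml.and (.mem 2 0) (Fml.ex (Fml.and (.mem 3 1) (.mem 3 2)))))
        (.eq 1 2)))))
    (Fml.ex (Fml.all (Fml.imp (.mem 2 0)
      (Fml.ex (Fml.and (Fml.and (.mem 3 2) (.mem 3 1))
        (Fml.all (Fml.imp (Fml.and (.mem 4 2) (.mem 4 1)) (.eq 4 3)))))))))

/-- An instance of the separation schema, for a formula `φ` with parameters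
`0, …, n-1` and distinguished variable `n`. -/
def sepAx (n : ℕ) (φ : Fml (n + 1)) : Fml 0 :=
  Fml.alls ((Fml.ex (Fml.all (Fml.iff
    (Fml.mem (⟨n + 2, by omega⟩ : Fin (n + 3)) ⟨n + 1, by omega⟩)
    (Fml.and (Fml.mem (⟨n + 2, by omega⟩ : Fin (n + 3)) ⟨n, by omega⟩)
      (Fml.rename (fun i => if h : (i : ℕ) < n then (⟨i, by omega⟩ : Fin (n + 3))
        else ⟨n + 2, by omega⟩) φ))))) : Fml (n + 1))

/-- An instance of the collection schema, for a formula `φ` with parameters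
`0, …, n-1` and distinguished variables `n` (input) and `n+1` (output). -/
def collAx (n : ℕ) (φ : Fml (n + 2)) : Fml 0 :=
  let φ' : Fml (n + 4) := Fml.rename (fun i => if h : (i : ℕ) < n then (⟨i, by omega⟩ : Fin (n + 4))
    else ⟨(i : ℕ) + 2, by have := i.isLt; omega⟩) φ
  Fml.alls ((Fml.ex (Fml.all
    (Fml.imp (Fml.mem (⟨n + 2, by omega⟩ : Fin (n + 3)) ⟨n, by omega⟩)
      (Fml.imp (Fml.ex φ')
        (Fml.ex (Fml.and (Fml.mem (⟨n + 3, by omega⟩ : Fin (n + 4)) ⟨n + 1, by omega⟩) φ')))))) : Fml (n + 1))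

/-- The ZFC axioms. -/
def ZFCax : Set (Fml 0) :=
  {extAx, pairAx, unionAx, powerAx, infAx, foundAx, choiceAx} ∪
    (⋃ n, Set.range (sepAx n)) ∪ (⋃ n, Set.range (collAx n))

/-- A transitive set model of ZFC. -/
def IsZFModel (m : ZFSet) : Prop := m.IsTransitive ∧ ∀ φ ∈ ZFCax, Sat m.toSet φ

/-- A countable transitive model of ZFC. -/
def IsCtm (m : ZFSet) : Prop := IsZFModel m ∧ m.toSet.Countable

/-! ### Basic set-theoretic notions -/

/-- `x` is a (von Neumann) ordinal: a transitive set of transitive sets. -/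
def IsOrd (x : ZFSet) : Prop := x.IsTransitive ∧ ∀ y ∈ x, ZFSet.IsTransitive y

/-- `x ≤ y` for ordinals. -/
def oLe (x y : ZFSet) : Prop := x ∈ y ∨ x = y

/-- `f` is a function with domain `d` (coded as a set of Kuratowski pairs). -/
def IsFuncOn (d f : ZFSet) : Prop :=
  (∀ p ∈ f, ∃ a b : ZFSet, a ∈ d ∧ p = a.pair b) ∧ ∀ a ∈ d, ∃! b : ZFSet, a.pair b ∈ f

/-- All values of the (partial) function `f` lie in `b`. -/
def MapsInto (f b : ZFSet) : Prop := ∀ x y : ZFSet, x.pair y ∈ f → y ∈ b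

/-- The function `f` is injective. -/
def InjFun (f : ZFSet) : Prop := ∀ x x' y : ZFSet, x.pair y ∈ f → x'.pair y ∈ f → x = x'

/-- `|a| ≤ |b|`, witnessed by an injection belonging to the universe class `W`. -/
def SetLeIn (W : Set ZFSet) (a b : ZFSet) : Prop :=
  ∃ f ∈ W, IsFuncOn a f ∧ MapsInto f b ∧ InjFun f

/-- `κ` is a cardinal (relative to the universe class `W`). -/
def IsCardIn (W : Set ZFSet) (κ : ZFSet) : Prop :=
  IsOrd κ ∧ ∀ α ∈ κ, ¬ SetLeIn W κ α

/-- `M` is a transitive class. -/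
def TransClass (M : Set ZFSet) : Prop := ∀ x ∈ M, ∀ y : ZFSet, y ∈ x → y ∈ M

/-- An elementary embedding `j : (W, ∈) → (M, ∈)` between two classes. -/
structure ElemEmb (W M : Set ZFSet) where
  toFun : ZFSet → ZFSet
  maps : ∀ x ∈ W, toFun x ∈ M
  elem : ∀ {n : ℕ} (φ : Fml n) (v : Fin n → ZFSet), (∀ i, v i ∈ W) →
    (Fml.Realize W φ v ↔ Fml.Realize M φ (fun i => toFun (v i)))

/-- `κ` is the critical point of `j`: the least ordinal moved. -/
def IsCrit {W M : Set ZFSet} (j : ElemEmb W M) (κ : ZFSet) : Prop :=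
  IsOrd κ ∧ j.toFun κ ≠ κ ∧ ∀ α ∈ κ, j.toFun α = α

/-! ### The rank hierarchy -/

/-- `x ∈ V_lam`. -/
def VMem (lam x : ZFSet) : Prop := x.rank < lam.rank

/-- `V_lam ⊆ M` (with `V_lam` computed in the universe class `W`). -/
def VInclIn (W M : Set ZFSet) (lam : ZFSet) : Prop := ∀ x ∈ W, VMem lam x → x ∈ M

/-- `A ⊆ V_δ`. -/
def SubV (A δ : ZFSet) : Prop := ∀ x ∈ A, VMem δ x

/-- `A ∩ V_lam = B ∩ V_lam`. -/
def AgreeBelowIn (W : Set ZFSet) (lam A B : ZFSet) : Prop :=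
  ∀ x ∈ W, VMem lam x → (x ∈ A ↔ x ∈ B)

/-- `A ∩ lam = B ∩ lam` (for sets of ordinals). -/
def AgreeMem (lam A B : ZFSet) : Prop := ∀ ξ ∈ lam, (ξ ∈ A ↔ ξ ∈ B)

/-! ### Covering properties -/

/-- `M ⊨ |s| < t`: in `M` there is an injection of `s` into some ordinal `β ∈ t`. -/
def CardLtIn (M : Set ZFSet) (s t : ZFSet) : Prop :=
  ∃ β f : ZFSet, β ∈ t ∧ f ∈ M ∧ IsFuncOn s f ∧ MapsInto f β ∧ InjFun f

/-- `j` satisfies the weak `lam`-covering property (with target class `M`):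
there is `s ∈ M` with `j '' lam ⊆ s` and `M ⊨ |s| < j κ`. -/
def WCovers (M : Set ZFSet) (j : ZFSet → ZFSet) (κ lam : ZFSet) : Prop :=
  ∃ s ∈ M, (∀ α ∈ lam, j α ∈ s) ∧ CardLtIn M s (j κ)

/-- `j` satisfies the (full) `lam`-covering property: every `X ∈ W` with
`X ⊆ M` and `|X| ≤ lam` is covered by some `s ∈ M` with `M ⊨ |s| < j κ`. -/
def CoversIn (W M : Set ZFSet) (j : ZFSet → ZFSet) (κ lam : ZFSet) : Prop :=
  ∀ X ∈ W, X.toSet ⊆ M → SetLeIn W X lam → ∃ s ∈ M, X ⊆ s ∧ CardLtIn M s (j κ)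

/-! ### Strongness -/

/-- `κ` is `lam`-strong. -/
def LamStrongIn (W : Set ZFSet) (κ lam : ZFSet) : Prop :=
  ∃ M : Set ZFSet, M ⊆ W ∧ TransClass M ∧ ∃ j : ElemEmb W M,
    IsCrit j κ ∧ lam ∈ j.toFun κ ∧ VInclIn W M lam

/-- `κ` is `lam`-strong for `A`. -/
def LamStrongForIn (W : Set ZFSet) (κ lam A : ZFSet) : Prop :=
  ∃ M : Set ZFSet, M ⊆ W ∧ TransClass M ∧ ∃ j : ElemEmb W M,
    IsCrit j κ ∧ lam ∈ j.toFun κ ∧ VInclIn W M lam ∧ AgreeBelowIn W lam A (j.toFun A)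

/-- `κ` is `<δ`-strong. -/
def LtStrongIn (W : Set ZFSet) (κ δ : ZFSet) : Prop :=
  ∀ lam : ZFSet, oLe κ lam → lam ∈ δ → LamStrongIn W κ lam

/-- `κ` is `<δ`-strong for `A`. -/
def LtStrongForIn (W : Set ZFSet) (κ δ A : ZFSet) : Prop :=
  ∀ lam : ZFSet, oLe κ lam → lam ∈ δ → LamStrongForIn W κ lam A

/-! ### Strong compactness -/

/-- `κ` is `lam`-strongly compact (there is an embedding with critical point `κ`,
`j κ > lam`, satisfying the weak `lam`-covering property). -/
def LamSCIn (W : Set ZFSet) (κ lam : ZFSet) : Prop :=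
  ∃ M : Set ZFSet, M ⊆ W ∧ TransClass M ∧ ∃ j : ElemEmb W M,
    IsCrit j κ ∧ lam ∈ j.toFun κ ∧ WCovers M j.toFun κ lam

/-- `κ` is `lam`-strongly compact for the set of ordinals `A`: there is a
`lam`-strong compactness embedding `j` (one with the full `lam`-covering
property) with critical point `κ` and `A ∩ lam = j A ∩ lam`. -/
def LamSCForIn (W : Set ZFSet) (κ lam A : ZFSet) : Prop :=
  ∃ M : Set ZFSet, M ⊆ W ∧ TransClass M ∧ ∃ j : ElemEmb W M,
    IsCrit j κ ∧ lam ∈ j.toFun κ ∧ CoversIn W M j.toFun κ lam ∧ AgreeMem lam A (j.toFun A)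

/-- `κ` is `<δ`-strongly compact. -/
def LtSCIn (W : Set ZFSet) (κ δ : ZFSet) : Prop :=
  ∀ lam : ZFSet, oLe κ lam → lam ∈ δ → LamSCIn W κ lam

/-- `κ` is `<δ`-strongly compact for `A`. -/
def LtSCForIn (W : Set ZFSet) (κ δ A : ZFSet) : Prop :=
  ∀ lam : ZFSet, oLe κ lam → lam ∈ δ → LamSCForIn W κ lam A

/-! ### Supercompactness -/

/-- `M` is closed under `lam`-sequences (from the universe class `W`). -/
def SeqClosedIn (W M : Set ZFSet) (lam : ZFSet) : Prop :=
  ∀ f ∈ W, IsFuncOn lam f → (∀ x y : ZFSet, x.pair y ∈ f → y ∈ M) → f ∈ M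

/-- `κ` is `lam`-supercompact. -/
def LamSupercompactIn (W : Set ZFSet) (κ lam : ZFSet) : Prop :=
  ∃ M : Set ZFSet, M ⊆ W ∧ TransClass M ∧ ∃ j : ElemEmb W M,
    IsCrit j κ ∧ lam ∈ j.toFun κ ∧ SeqClosedIn W M lam

/-- `κ` is `lam`-supercompact for `A`. -/
def LamSupercompactForIn (W : Set ZFSet) (κ lam A : ZFSet) : Prop :=
  ∃ M : Set ZFSet, M ⊆ W ∧ TransClass M ∧ ∃ j : ElemEmb W M,
    IsCrit j κ ∧ lam ∈ j.toFun κ ∧ SeqClosedIn W M lam ∧ AgreeBelowIn W lam A (j.toFun A)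

/-- `κ` is `<δ`-supercompact. -/
def LtSupercompactIn (W : Set ZFSet) (κ δ : ZFSet) : Prop :=
  ∀ lam : ZFSet, oLe κ lam → lam ∈ δ → LamSupercompactIn W κ lam

/-- `κ` is `<δ`-supercompact for `A`. -/
def LtSupercompactForIn (W : Set ZFSet) (κ δ A : ZFSet) : Prop :=
  ∀ lam : ZFSet, oLe κ lam → lam ∈ δ → LamSupercompactForIn W κ lam A

/-! ### The global large-cardinal notions -/

/-- `δ` is a Woodin cardinal. -/
def WoodinIn (W : Set ZFSet) (δ : ZFSet) : Prop :=
  IsCardIn W δ ∧ ∀ A ∈ W, SubV A δ → ∃ κ, κ ∈ δ ∧ LtStrongForIn W κ δ A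

/-- `δ` is a Woodin for strong compactness cardinal. -/
def WoodinSCIn (W : Set ZFSet) (δ : ZFSet) : Prop :=
  IsCardIn W δ ∧ ∀ A ∈ W, A ⊆ δ → ∃ κ, κ ∈ δ ∧ LtSCForIn W κ δ A

/-- `δ` is a Vopěnka cardinal. -/
def VopenkaIn (W : Set ZFSet) (δ : ZFSet) : Prop :=
  IsCardIn W δ ∧ ∀ A ∈ W, SubV A δ → ∃ κ, κ ∈ δ ∧ LtSupercompactForIn W κ δ A

/-- `δ` is Woodin and a limit of `<δ`-supercompact cardinals. -/
def WoodinLimSupercompactIn (W : Set ZFSet) (δ : ZFSet) : Prop :=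
  WoodinIn W δ ∧ ∀ α ∈ δ, ∃ κ : ZFSet, α ∈ κ ∧ κ ∈ δ ∧ LtSupercompactIn W κ δ

/-! ### Inaccessibility -/

/-- `δ` is a regular ordinal: the range of any function from a smaller
ordinal into `δ` is bounded. -/
def RegularIn (W : Set ZFSet) (δ : ZFSet) : Prop :=
  IsOrd δ ∧ ∀ α ∈ δ, ∀ f ∈ W, IsFuncOn α f → MapsInto f δ →
    ∃ β ∈ δ, ∀ x y : ZFSet, x.pair y ∈ f → y ∈ β

/-- The power set of `x` relative to `W`. -/
def powersetIn (W : Set ZFSet) (x : ZFSet) : ZFSet := ZFSet.sep (fun z => z ∈ W) x.powerset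

/-- `δ` is a strong limit cardinal. -/
def StrongLimitIn (W : Set ZFSet) (δ : ZFSet) : Prop :=
  IsCardIn W δ ∧ ∀ α ∈ δ, ∃ β ∈ δ, SetLeIn W (powersetIn W α) β

/-- `δ` is inaccessible: an uncountable regular strong limit cardinal. -/
def InaccessibleIn (W : Set ZFSet) (δ : ZFSet) : Prop :=
  ZFSet.omega ∈ δ ∧ IsCardIn W δ ∧ RegularIn W δ ∧ StrongLimitIn W δ

/-! ### Ultrafilters and measurability -/

/-- Relative complement `a \ b`. -/
def zdiff (a b : ZFSet) : ZFSet := ZFSet.sep (fun x => x ∉ b) a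

/-- Intersection `a ∩ b`. -/
def zinter (a b : ZFSet) : ZFSet := ZFSet.sep (fun x => x ∈ b) a

/-- `U` is a nonprincipal `α`-complete ultrafilter on `α`. -/
def IsUfOnIn (W : Set ZFSet) (α U : ZFSet) : Prop :=
  (∀ x ∈ U, x ⊆ α) ∧ α ∈ U ∧ (∅ : ZFSet) ∉ U ∧
  (∀ x ∈ U, ∀ y : ZFSet, y ∈ W → y ⊆ α → x ⊆ y → y ∈ U) ∧
  (∀ x ∈ W, x ⊆ α → (x ∈ U ∨ zdiff α x ∈ U)) ∧
  (∀ β ∈ α, ∀ g ∈ W, IsFuncOn β g → MapsInto g U →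
    ZFSet.sep (fun ξ => ∀ p q : ZFSet, p.pair q ∈ g → ξ ∈ q) α ∈ U) ∧
  (∀ ξ ∈ α, ZFSet.sep (fun x => x = ξ) α ∉ U)

/-- `U` is a normal ultrafilter on `α`: a nonprincipal `α`-complete
ultrafilter closed under diagonal intersections. -/
def IsNormalUfOnIn (W : Set ZFSet) (α U : ZFSet) : Prop :=
  IsUfOnIn W α U ∧
    ∀ g ∈ W, IsFuncOn α g → MapsInto g U →
      ZFSet.sep (fun ξ => ∀ p q : ZFSet, p.pair q ∈ g → p ∈ ξ → ξ ∈ q) α ∈ U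

/-- `α` is a measurable cardinal. -/
def MeasurableIn (W : Set ZFSet) (α : ZFSet) : Prop := ∃ U ∈ W, IsUfOnIn W α U

/-! ### Functions `f : δ → δ` and closure points -/

/-- `f` codes a function from `δ` to `δ`. -/
def FuncSelf (δ f : ZFSet) : Prop := IsFuncOn δ f ∧ MapsInto f δ

/-- `κ` is a closure point of `f`, i.e. `f '' κ ⊆ κ`. -/
def ClosurePt (f κ : ZFSet) : Prop := ∀ x y : ZFSet, x.pair y ∈ f → x ∈ κ → y ∈ κ

/-! ### GCH -/

/-- GCH: for every infinite cardinal `κ`, any family of subsets of `κ` has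
size at most `κ` or size at least that of the full power set of `κ`. -/
def GCHIn (W : Set ZFSet) : Prop :=
  ∀ κ ∈ W, IsCardIn W κ → oLe ZFSet.omega κ →
    ∀ X ∈ W, (∀ z ∈ X, z ⊆ κ) → (SetLeIn W X κ ∨ SetLeIn W (powersetIn W κ) X)

/-! ### Forcing -/

/-- `(P, R)` is a forcing notion (a preordered set, `x.pair y ∈ R` meaning
`x ≤ y`, i.e. `x` is stronger than `y`). -/
def IsPoset (P R : ZFSet) : Prop :=
  (∀ p ∈ P, p.pair p ∈ R) ∧
  (∀ p q r : ZFSet, p.pair q ∈ R → q.pair r ∈ R → p.pair r ∈ R) ∧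
  (∀ x y : ZFSet, x.pair y ∈ R → x ∈ P ∧ y ∈ P)

/-- `G` is an `m`-generic filter on the forcing notion `(P, R) ∈ m`. -/
def IsGenericFilter (m P R G : ZFSet) : Prop :=
  G ⊆ P ∧
  (∀ p ∈ G, ∀ q ∈ P, p.pair q ∈ R → q ∈ G) ∧
  (∀ p ∈ G, ∀ q ∈ G, ∃ r ∈ G, r.pair p ∈ R ∧ r.pair q ∈ R) ∧
  (∀ D ∈ m, (D ⊆ P ∧ ∀ p ∈ P, ∃ q ∈ D, q.pair p ∈ R) → ∃ q, q ∈ G ∧ q ∈ D)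

/-- `n = m[G]` : `n` is a transitive ZFC-model extending `m` and containing
`G`, and is the least such. -/
def IsGenericExt (m G n : ZFSet) : Prop :=
  IsZFModel n ∧ m ⊆ n ∧ G ∈ n ∧
    ∀ n' : ZFSet, IsZFModel n' → m ⊆ n' → G ∈ n' → n ⊆ n'

/-- `n` is a (set-)forcing extension of the transitive model `m`. -/
def IsForcingExt (m n : ZFSet) : Prop :=
  ∃ P R G : ZFSet, P ∈ m ∧ R ∈ m ∧ IsPoset P R ∧
    IsGenericFilter m P R G ∧ IsGenericExt m G n

/-! ### Ambient (full-universe) abbreviations -/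

abbrev LamStrong (κ lam : ZFSet) : Prop := LamStrongIn Set.univ κ lam
abbrev LamStrongFor (κ lam A : ZFSet) : Prop := LamStrongForIn Set.univ κ lam A
abbrev LtStrong (κ δ : ZFSet) : Prop := LtStrongIn Set.univ κ δ
abbrev LtStrongFor (κ δ A : ZFSet) : Prop := LtStrongForIn Set.univ κ δ A
abbrev LamSC (κ lam : ZFSet) : Prop := LamSCIn Set.univ κ lam
abbrev LamSCFor (κ lam A : ZFSet) : Prop := LamSCForIn Set.univ κ lam A
abbrev LtSC (κ δ : ZFSet) : Prop := LtSCIn Set.univ κ δ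
abbrev LtSCFor (κ δ A : ZFSet) : Prop := LtSCForIn Set.univ κ δ A
abbrev LamSupercompact (κ lam : ZFSet) : Prop := LamSupercompactIn Set.univ κ lam
abbrev LtSupercompact (κ δ : ZFSet) : Prop := LtSupercompactIn Set.univ κ δ
abbrev Woodin (δ : ZFSet) : Prop := WoodinIn Set.univ δ
abbrev WoodinSC (δ : ZFSet) : Prop := WoodinSCIn Set.univ δ
abbrev Vopenka (δ : ZFSet) : Prop := VopenkaIn Set.univ δ
abbrev IsCard (κ : ZFSet) : Prop := IsCardIn Set.univ κ
abbrev Inaccessible (δ : ZFSet) : Prop := InaccessibleIn Set.univ δ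
abbrev Covers (M : Set ZFSet) (j : ZFSet → ZFSet) (κ lam : ZFSet) : Prop :=
  CoversIn Set.univ M j κ lam
abbrev VIncl (M : Set ZFSet) (lam : ZFSet) : Prop := VInclIn Set.univ M lam
abbrev AgreeBelow (lam A B : ZFSet) : Prop := AgreeBelowIn Set.univ lam A B
abbrev SeqClosed (M : Set ZFSet) (lam : ZFSet) : Prop := SeqClosedIn Set.univ M lam

/-! ### Tools: semantics of formulas over transitive classes -/

section Tools

open ZFSet Fml

theorem realize_mem {C : Set ZFSet} {n} (i k : Fin n) (v) :
    Realize C (.mem i k) v ↔ v i ∈ v k := by simp [Realize]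
theorem realize_eq {C : Set ZFSet} {n} (i k : Fin n) (v) :
    Realize C (.eq i k) v ↔ v i = v k := by simp [Realize]
theorem realize_not {C : Set ZFSet} {n} (φ : Fml n) (v) :
    Realize C (.not φ) v ↔ ¬ Realize C φ v := by simp [Realize]
theorem realize_and {C : Set ZFSet} {n} (φ ψ : Fml n) (v) :
    Realize C (.and φ ψ) v ↔ Realize C φ v ∧ Realize C ψ v := by simp [Realize]
theorem realize_ex {C : Set ZFSet} {n} (φ : Fml (n + 1)) (v) :
    Realize C (.ex φ) v ↔ ∃ x ∈ C, Realize C φ (Fin.snoc v x) := by simp [Realize]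
theorem realize_or {C : Set ZFSet} {n} (φ ψ : Fml n) (v) :
    Realize C (Fml.or φ ψ) v ↔ Realize C φ v ∨ Realize C ψ v := by
  simp only [Fml.or, realize_not, realize_and]; tauto
theorem realize_imp {C : Set ZFSet} {n} (φ ψ : Fml n) (v) :
    Realize C (Fml.imp φ ψ) v ↔ (Realize C φ v → Realize C ψ v) := by
  simp only [Fml.imp, realize_not, realize_or]; tauto
theorem realize_iff {C : Set ZFSet} {n} (φ ψ : Fml n) (v) :
    Realize C (Fml.iff φ ψ) v ↔ (Realize C φ v ↔ Realize C ψ v) := by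
  simp only [Fml.iff, realize_and, realize_imp]; tauto
theorem realize_all {C : Set ZFSet} {n} (φ : Fml (n + 1)) (v) :
    Realize C (Fml.all φ) v ↔ ∀ x ∈ C, Realize C φ (Fin.snoc v x) := by
  simp only [Fml.all, realize_not, realize_ex]; push Not; rfl

/-- `v k = {v i, v j}` -/
def fUp {n} (i j k : Fin n) : Fml n :=
  .and (.mem i k) (.and (.mem j k)
    (Fml.all (Fml.imp (.mem (Fin.last n) k.castSucc)
      (Fml.or (.eq (Fin.last n) i.castSucc) (.eq (Fin.last n) j.castSucc)))))

theorem realize_fUp {C : Set ZFSet} (hC : TransClass C) {n} (i j k : Fin n) (v : Fin n → ZFSet)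
    (h : v k ∈ C) : Realize C (fUp i j k) v ↔ v k = {v i, v j} := by
  simp only [fUp, realize_and, realize_mem, realize_all, realize_imp, realize_or, realize_eq,
    Fin.snoc_castSucc, Fin.snoc_last]
  constructor
  · rintro ⟨h1, h2, h3⟩
    ext z
    rw [mem_pair]
    constructor
    · intro hz; exact h3 z (hC _ h _ hz) hz
    · rintro (rfl | rfl) <;> assumption
  · intro e
    rw [e]
    simp

/-- `v k = pair (v i) (v j)` -/
def fPair {n} (i j k : Fin n) : Fml n :=
  .ex (.ex (.and (fUp (Fin.last n).castSucc (Fin.last (n + 1)) k.castSucc.castSucc)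
    (.and (fUp i.castSucc.castSucc i.castSucc.castSucc (Fin.last n).castSucc)
      (fUp i.castSucc.castSucc j.castSucc.castSucc (Fin.last (n + 1))))))

theorem realize_fPair {C : Set ZFSet} (hC : TransClass C) {n} (i j k : Fin n)
    (v : Fin n → ZFSet) (h : v k ∈ C) :
    Realize C (fPair i j k) v ↔ v k = pair (v i) (v j) := by
  simp only [fPair, realize_and, realize_ex]
  constructor
  · rintro ⟨a, ha, b, hb, h1, h2, h3⟩
    rw [realize_fUp hC _ _ _ _ (by simpa using h)] at h1
    rw [realize_fUp hC _ _ _ _ (by simpa using ha)] at h2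
    rw [realize_fUp hC _ _ _ _ (by simpa using hb)] at h3
    simp only [Fin.snoc_castSucc, Fin.snoc_last] at h1 h2 h3
    rw [h1, h2, h3, pair, pair_eq_singleton]
  · intro e
    have ha : ({v i} : ZFSet) ∈ C := hC _ h _ (by rw [e, pair]; simp)
    have hb : ({v i, v j} : ZFSet) ∈ C := hC _ h _ (by rw [e, pair]; simp)
    refine ⟨_, ha, _, hb, ?_, ?_, ?_⟩
    · rw [realize_fUp hC _ _ _ _ (by simpa using h)]
      simpa [pair] using e
    · rw [realize_fUp hC _ _ _ _ (by simpa using ha)]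
      simp
    · rw [realize_fUp hC _ _ _ _ (by simpa using hb)]
      simp

/-- `pair (v i) (v j) ∈ v k` -/
def pm {n} (i j k : Fin n) : Fml n :=
  .ex (.and (.mem (Fin.last n) k.castSucc) (fPair i.castSucc j.castSucc (Fin.last n)))

theorem realize_pm {C : Set ZFSet} (hC : TransClass C) {n} (i j k : Fin n)
    (v : Fin n → ZFSet) :
    Realize C (pm i j k) v ↔ pair (v i) (v j) ∈ C ∧ pair (v i) (v j) ∈ v k := by
  simp only [pm, realize_and, realize_ex, realize_mem]
  constructor
  · rintro ⟨a, ha, h1, h2⟩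
    rw [realize_fPair hC _ _ _ _ (by simpa using ha)] at h2
    simp only [Fin.snoc_castSucc, Fin.snoc_last] at h1 h2
    rw [← h2]
    exact ⟨ha, h1⟩
  · rintro ⟨ha, e⟩
    refine ⟨_, ha, ?_, ?_⟩
    · simpa using e
    · rw [realize_fPair hC _ _ _ _ (by simpa using ha)]
      simp

theorem mem_of_pair_mem {C : Set ZFSet} (hC : TransClass C) {x y : ZFSet} (h : pair x y ∈ C) :
    x ∈ C ∧ y ∈ C := by
  have hb : ({x, y} : ZFSet) ∈ C := hC _ h _ (by rw [pair]; simp)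
  exact ⟨hC _ hb _ (by simp), hC _ hb _ (by simp)⟩

/-- `pair (pair (v i) (v j)) (v k) ∈ v l` -/
def pm2 {n} (i j k l : Fin n) : Fml n :=
  .ex (.and (pm (Fin.last n) k.castSucc l.castSucc) (fPair i.castSucc j.castSucc (Fin.last n)))

theorem realize_pm2 {C : Set ZFSet} (hC : TransClass C) {n} (i j k l : Fin n)
    (v : Fin n → ZFSet) :
    Realize C (pm2 i j k l) v ↔ pair (pair (v i) (v j)) (v k) ∈ C ∧
      pair (pair (v i) (v j)) (v k) ∈ v l := by
  simp only [pm2, realize_and, realize_ex]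
  constructor
  · rintro ⟨a, ha, h1, h2⟩
    rw [realize_fPair hC _ _ _ _ (by simpa using ha)] at h2
    rw [realize_pm hC] at h1
    simp only [Fin.snoc_castSucc, Fin.snoc_last] at h1 h2
    rwa [← h2]
  · rintro ⟨e0, e⟩
    have ha := (mem_of_pair_mem hC e0).1
    refine ⟨_, ha, ?_, ?_⟩
    · rw [realize_pm hC]
      simpa using ⟨e0, e⟩
    · rw [realize_fPair hC _ _ _ _ (by simpa using ha)]
      simp

theorem transClass_univ : TransClass Set.univ := fun _ _ _ _ => trivial

section Emb

variable {M : Set ZFSet} (j : ElemEmb Set.univ M)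

theorem ElemEmb.mem_M (x : ZFSet) : j.toFun x ∈ M := j.maps x trivial

theorem ElemEmb.tr1 (φ : Fml 1) (a : ZFSet) :
    Realize Set.univ φ ![a] ↔ Realize M φ ![j.toFun a] := by
  rw [j.elem φ ![a] (fun _ => trivial)]
  exact iff_of_eq (congrArg _ (by ext i; fin_cases i <;> rfl))
theorem ElemEmb.tr2 (φ : Fml 2) (a b : ZFSet) :
    Realize Set.univ φ ![a, b] ↔ Realize M φ ![j.toFun a, j.toFun b] := by
  rw [j.elem φ ![a, b] (fun _ => trivial)]
  exact iff_of_eq (congrArg _ (by ext i; fin_cases i <;> rfl))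
theorem ElemEmb.tr3 (φ : Fml 3) (a b c : ZFSet) :
    Realize Set.univ φ ![a, b, c] ↔ Realize M φ ![j.toFun a, j.toFun b, j.toFun c] := by
  rw [j.elem φ ![a, b, c] (fun _ => trivial)]
  exact iff_of_eq (congrArg _ (by ext i; fin_cases i <;> rfl))

theorem ElemEmb.map_mem {a b : ZFSet} : a ∈ b ↔ j.toFun a ∈ j.toFun b := by
  simpa [realize_mem] using j.tr2 (.mem 0 1) a b

theorem ElemEmb.and_mem (hM : TransClass M) (a p : ZFSet) :
    (p ∈ M ∧ p ∈ j.toFun a) ↔ p ∈ j.toFun a :=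
  ⟨fun h => h.2, fun h => ⟨hM _ (j.mem_M a) _ h, h⟩⟩

theorem ElemEmb.h_empty (hM : TransClass M) : j.toFun ∅ = ∅ := by
  have := (j.tr1 (Fml.all (.not (.mem 1 0))) ∅).1 (by
    simp [realize_all, realize_not, realize_mem])
  simp only [realize_all, realize_not, realize_mem] at this
  rw [eq_empty]
  intro y hy
  exact this y (hM _ (j.mem_M _) _ hy) (by simpa using hy)

theorem ElemEmb.h_inter (hM : TransClass M) {a b c : ZFSet} (h : ∀ x, x ∈ a → x ∈ b → x ∈ c)
    {x : ZFSet} (h1 : x ∈ j.toFun a) (h2 : x ∈ j.toFun b) : x ∈ j.toFun c := by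
  have := (j.tr3 (Fml.all (.imp (.mem 3 0) (.imp (.mem 3 1) (.mem 3 2)))) a b c).1 (by
    simpa [realize_all, realize_imp, realize_mem] using h)
  simp [realize_all, realize_imp, realize_mem] at this
  exact this x (hM _ (j.mem_M _) _ h1) h1 h2

theorem ElemEmb.h_mono (hM : TransClass M) {a b : ZFSet} (h : ∀ x, x ∈ a → x ∈ b)
    {x : ZFSet} (h1 : x ∈ j.toFun a) : x ∈ j.toFun b :=
  j.h_inter hM (a := a) (b := a) (fun x hx _ => h x hx) h1 h1

theorem ElemEmb.h_disj (hM : TransClass M) {a b : ZFSet} (h : ∀ x, x ∈ a → x ∈ b → False)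
    {x : ZFSet} (h1 : x ∈ j.toFun a) (h2 : x ∈ j.toFun b) : False := by
  have := j.h_inter hM (a := a) (b := b) (c := ∅) (fun x hx hx' => (h x hx hx').elim) h1 h2
  rw [j.h_empty hM] at this
  exact notMem_empty _ this

theorem ElemEmb.h_cover (hM : TransClass M) {a b c : ZFSet} (h : ∀ x, x ∈ a → x ∈ b ∨ x ∈ c)
    {x : ZFSet} (h1 : x ∈ j.toFun a) : x ∈ j.toFun b ∨ x ∈ j.toFun c := by
  have := (j.tr3 (Fml.all (.imp (.mem 3 0) (.or (.mem 3 1) (.mem 3 2)))) a b c).1 (by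
    simpa [realize_all, realize_imp, realize_or, realize_mem] using h)
  simp [realize_all, realize_imp, realize_or, realize_mem] at this
  exact this x (hM _ (j.mem_M _) _ h1) h1

theorem ElemEmb.h_trans (hM : TransClass M) {a : ZFSet} (h : ∀ x ∈ a, ∀ y ∈ x, y ∈ a)
    {x y : ZFSet} (h1 : x ∈ j.toFun a) (h2 : y ∈ x) : y ∈ j.toFun a := by
  have := (j.tr1 (Fml.all (.imp (.mem 1 0) (Fml.all (.imp (.mem 2 1) (.mem 2 0))))) a).1 (by
    simpa [realize_all, realize_imp, realize_mem] using h)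
  simp [realize_all, realize_imp, realize_mem] at this
  have hx := hM _ (j.mem_M _) _ h1
  exact this x hx h1 y (hM _ hx _ h2) h2

theorem ElemEmb.pair_mem_M (hM : TransClass M) {a x y : ZFSet} (h : pair x y ∈ j.toFun a) :
    x ∈ M ∧ y ∈ M :=
  mem_of_pair_mem hM (hM _ (j.mem_M a) _ h)

theorem ElemEmb.h_mem (hM : TransClass M) {a b c : ZFSet}
    (h : ∀ x y z, pair x y ∈ a → pair x z ∈ b → (x ∈ c ↔ y ∈ z))
    {x y z : ZFSet} (h1 : pair x y ∈ j.toFun a) (h2 : pair x z ∈ j.toFun b) :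
    x ∈ j.toFun c ↔ y ∈ z := by
  have := (j.tr3 (Fml.all (Fml.all (Fml.all (.imp (pm 3 4 0) (.imp (pm 3 5 1)
    (.iff (.mem 3 2) (.mem 4 5))))))) a b c).1 (by
    simpa [realize_all, realize_imp, realize_iff, realize_mem,
      realize_pm transClass_univ] using h)
  simp [realize_all, realize_imp, realize_iff, realize_mem,
      realize_pm hM, j.and_mem hM] at this
  exact this x (j.pair_mem_M hM h1).1 y (j.pair_mem_M hM h1).2 z (j.pair_mem_M hM h2).2 h1 h2

theorem ElemEmb.h_eq (hM : TransClass M) {a b c : ZFSet}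
    (h : ∀ x y z, pair x y ∈ a → pair x z ∈ b → (x ∈ c ↔ y = z))
    {x y z : ZFSet} (h1 : pair x y ∈ j.toFun a) (h2 : pair x z ∈ j.toFun b) :
    x ∈ j.toFun c ↔ y = z := by
  have := (j.tr3 (Fml.all (Fml.all (Fml.all (.imp (pm 3 4 0) (.imp (pm 3 5 1)
    (.iff (.mem 3 2) (.eq 4 5))))))) a b c).1 (by
    simpa [realize_all, realize_imp, realize_iff, realize_mem, realize_eq, realize_pm transClass_univ] using h)
  simp [realize_all, realize_imp, realize_iff, realize_mem, realize_eq, realize_pm hM, j.and_mem hM] at this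
  exact this x (j.pair_mem_M hM h1).1 y (j.pair_mem_M hM h1).2 z (j.pair_mem_M hM h2).2 h1 h2

theorem ElemEmb.h_fst (hM : TransClass M) {a b c : ZFSet}
    (h : ∀ x y z, pair x y ∈ a → pair x z ∈ b → pair (pair x z) y ∈ c)
    {x y z : ZFSet} (h1 : pair x y ∈ j.toFun a) (h2 : pair x z ∈ j.toFun b) :
    pair (pair x z) y ∈ j.toFun c := by
  have := (j.tr3 (Fml.all (Fml.all (Fml.all (.imp (pm 3 4 0) (.imp (pm 3 5 1)
    (pm2 3 5 4 2)))))) a b c).1 (by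
    simpa [realize_all, realize_imp,
      realize_pm transClass_univ, realize_pm2 transClass_univ] using h)
  simp [realize_all, realize_imp,
      realize_pm hM, realize_pm2 hM, j.and_mem hM] at this
  exact this x (j.pair_mem_M hM h1).1 y (j.pair_mem_M hM h1).2 z (j.pair_mem_M hM h2).2 h1 h2

theorem ElemEmb.h_snd (hM : TransClass M) {a b : ZFSet}
    (h : ∀ x y, pair x y ∈ a → pair (pair x y) y ∈ b)
    {x y : ZFSet} (h1 : pair x y ∈ j.toFun a) : pair (pair x y) y ∈ j.toFun b := by
  have := (j.tr2 (Fml.all (Fml.all (.imp (pm 2 3 0) (pm2 2 3 3 1)))) a b).1 (by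
    simpa [realize_all, realize_imp,
      realize_pm transClass_univ, realize_pm2 transClass_univ] using h)
  simp [realize_all, realize_imp,
      realize_pm hM, realize_pm2 hM, j.and_mem hM] at this
  exact this x (j.pair_mem_M hM h1).1 y (j.pair_mem_M hM h1).2 h1

theorem ElemEmb.h_pre1 (hM : TransClass M) {a b c : ZFSet}
    (h : ∀ x m y, pair x m ∈ a → pair m y ∈ b → pair x y ∈ c)
    {x m y : ZFSet} (h1 : pair x m ∈ j.toFun a) (h2 : pair m y ∈ j.toFun b) :
    pair x y ∈ j.toFun c := by
  have := (j.tr3 (Fml.all (Fml.all (Fml.all (.imp (pm 3 4 0) (.imp (pm 4 5 1)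
    (pm 3 5 2)))))) a b c).1 (by
    simpa [realize_all, realize_imp,
      realize_pm transClass_univ] using h)
  simp [realize_all, realize_imp,
      realize_pm hM, j.and_mem hM] at this
  exact this x (j.pair_mem_M hM h1).1 m (j.pair_mem_M hM h1).2 y (j.pair_mem_M hM h2).2 h1 h2

theorem ElemEmb.h_pre2 (hM : TransClass M) {a b c : ZFSet}
    (h : ∀ x m y, pair x m ∈ a → pair x y ∈ b → pair m y ∈ c)
    {x m y : ZFSet} (h1 : pair x m ∈ j.toFun a) (h2 : pair x y ∈ j.toFun b) :
    pair m y ∈ j.toFun c := by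
  have := (j.tr3 (Fml.all (Fml.all (Fml.all (.imp (pm 3 4 0) (.imp (pm 3 5 1)
    (pm 4 5 2)))))) a b c).1 (by
    simpa [realize_all, realize_imp,
      realize_pm transClass_univ] using h)
  simp [realize_all, realize_imp,
      realize_pm hM, j.and_mem hM] at this
  exact this x (j.pair_mem_M hM h1).1 m (j.pair_mem_M hM h1).2 y (j.pair_mem_M hM h2).2 h1 h2

theorem ElemEmb.h_dom1 (hM : TransClass M) {a b : ZFSet} (h : ∀ x y, pair x y ∈ a → x ∈ b)
    {x y : ZFSet} (h1 : pair x y ∈ j.toFun a) : x ∈ j.toFun b := by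
  have := (j.tr2 (Fml.all (Fml.all (.imp (pm 2 3 0) (.mem 2 1)))) a b).1 (by
    simpa [realize_all, realize_imp, realize_mem,
      realize_pm transClass_univ] using h)
  simp [realize_all, realize_imp, realize_mem,
      realize_pm hM, j.and_mem hM] at this
  exact this x (j.pair_mem_M hM h1).1 y (j.pair_mem_M hM h1).2 h1

theorem ElemEmb.h_ran1 (hM : TransClass M) {a b : ZFSet} (h : ∀ x y, pair x y ∈ a → y ∈ b)
    {x y : ZFSet} (h1 : pair x y ∈ j.toFun a) : y ∈ j.toFun b := by
  have := (j.tr2 (Fml.all (Fml.all (.imp (pm 2 3 0) (.mem 3 1)))) a b).1 (by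
    simpa [realize_all, realize_imp, realize_mem,
      realize_pm transClass_univ] using h)
  simp [realize_all, realize_imp, realize_mem,
      realize_pm hM, j.and_mem hM] at this
  exact this x (j.pair_mem_M hM h1).1 y (j.pair_mem_M hM h1).2 h1

theorem ElemEmb.h_dom2 (hM : TransClass M) {a b : ZFSet} (h : ∀ x ∈ a, ∃ y, pair x y ∈ b)
    {x : ZFSet} (h1 : x ∈ j.toFun a) : ∃ y, pair x y ∈ j.toFun b := by
  have := (j.tr2 (Fml.all (.imp (.mem 2 0) (Fml.ex (pm 2 3 1)))) a b).1 (by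
    simpa [realize_all, realize_ex, realize_imp, realize_mem,
      realize_pm transClass_univ] using h)
  simp [realize_all, realize_ex, realize_imp, realize_mem,
      realize_pm hM, j.and_mem hM] at this
  obtain ⟨y, _, hy⟩ := this x (hM _ (j.mem_M _) _ h1) h1
  exact ⟨y, hy⟩

theorem ElemEmb.h_prod (hM : TransClass M) {a b c : ZFSet}
    (h : ∀ x ∈ a, ∀ y ∈ b, pair x y ∈ c)
    {x y : ZFSet} (h1 : x ∈ j.toFun a) (h2 : y ∈ j.toFun b) : pair x y ∈ j.toFun c := by
  have := (j.tr3 (Fml.all (.imp (.mem 3 0) (Fml.all (.imp (.mem 4 1) (pm 3 4 2))))) a b c).1 (by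
    simpa [realize_all, realize_imp, realize_mem,
      realize_pm transClass_univ] using h)
  simp [realize_all, realize_imp, realize_mem,
      realize_pm hM, j.and_mem hM] at this
  exact this x (hM _ (j.mem_M _) _ h1) h1 y (hM _ (j.mem_M _) _ h2) h2

theorem ElemEmb.h_tr (hM : TransClass M) {a b : ZFSet}
    (h : ∀ x y, pair x y ∈ a → ∀ z ∈ y, pair x z ∈ b)
    {x y z : ZFSet} (h1 : pair x y ∈ j.toFun a) (h2 : z ∈ y) : pair x z ∈ j.toFun b := by
  have := (j.tr2 (Fml.all (Fml.all (.imp (pm 2 3 0)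
    (Fml.all (.imp (.mem 4 3) (pm 2 4 1)))))) a b).1 (by
    simpa [realize_all, realize_imp, realize_mem,
      realize_pm transClass_univ] using h)
  simp [realize_all, realize_imp, realize_mem,
      realize_pm hM, j.and_mem hM] at this
  have hy := (j.pair_mem_M hM h1).2
  exact this x (j.pair_mem_M hM h1).1 y hy h1 z (hM _ hy _ h2) h2

theorem ElemEmb.h_rank (hM : TransClass M) {l b : ZFSet}
    (h : ∀ α ∈ l, ∀ x, (pair α x ∈ b ↔ ∃ β, β ∈ α ∧ ∀ y, y ∈ x → pair β y ∈ b))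
    {α x : ZFSet} (h1 : α ∈ j.toFun l) (h2 : x ∈ M) :
    pair α x ∈ j.toFun b ↔ ∃ β, β ∈ α ∧ ∀ y, y ∈ x → pair β y ∈ j.toFun b := by
  have := (j.tr2 (Fml.all (.imp (.mem 2 0) (Fml.all (.iff (pm 2 3 1) (Fml.ex (.and (.mem 4 2)
    (Fml.all (.imp (.mem 5 3) (pm 4 5 1))))))))) l b).1 (by
    simpa [realize_all, realize_ex, realize_and, realize_iff, realize_imp, realize_mem, realize_pm transClass_univ] using h)
  simp [realize_all, realize_ex, realize_and, realize_iff, realize_imp, realize_mem, realize_pm hM, j.and_mem hM] at this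
  have hα := hM _ (j.mem_M _) _ h1
  rw [this α hα h1 x h2]
  constructor
  · rintro ⟨β, _, hβ, H⟩
    exact ⟨β, hβ, fun y hy => H y (hM _ h2 _ hy) hy⟩
  · rintro ⟨β, hβ, H⟩
    exact ⟨β, hM _ hα _ hβ, hβ, fun y _ hy => H y hy⟩

end Emb
end Tools
/-! ### The class extension of an embedding and a Łoś theorem -/

section Main

open ZFSet Fml

theorem ElemEmb.h_diag {M : Set ZFSet} (j : ElemEmb Set.univ M) (hM : TransClass M) {a b : ZFSet}
    (h : ∀ x ∈ a, pair x x ∈ b)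
    {x : ZFSet} (h1 : x ∈ j.toFun a) : pair x x ∈ j.toFun b := by
  have := (j.tr2 (Fml.all (.imp (.mem 2 0) (pm 2 2 1))) a b).1 (by
    simpa [realize_all, realize_imp, realize_mem, realize_pm transClass_univ] using h)
  simp [realize_all, realize_imp, realize_mem, realize_pm hM, j.and_mem hM] at this
  exact this x (hM _ (j.mem_M _) _ h1) h1

/-- First coordinate of a pair. -/
noncomputable def pfst (z : ZFSet) : ZFSet := by
  classical exact if h : ∃ x y, z = pair x y then h.choose else ∅

/-- Second coordinate of a pair. -/
noncomputable def psnd (z : ZFSet) : ZFSet := by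
  classical exact if h : ∃ y x, z = pair x y then h.choose else ∅

@[simp] theorem pfst_pair (x y : ZFSet) : pfst (pair x y) = x := by
  have h : ∃ x' y', pair x y = pair x' y' := ⟨x, y, rfl⟩
  unfold pfst
  rw [dif_pos h]
  obtain ⟨y', hy'⟩ := h.choose_spec
  exact (pair_inj.1 hy').1.symm

@[simp] theorem psnd_pair (x y : ZFSet) : psnd (pair x y) = y := by
  have h : ∃ y' x', pair x y = pair x' y' := ⟨y, x, rfl⟩
  unfold psnd
  rw [dif_pos h]
  obtain ⟨y', hy'⟩ := h.choose_spec
  exact (pair_inj.1 hy').2.symm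

/-- Image of a set under an arbitrary function. -/
noncomputable def img (f : ZFSet → ZFSet) (a : ZFSet) : ZFSet :=
  letI : Definable₁ f := Classical.allZFSetDefinable _
  ZFSet.image f a

theorem mem_img {f : ZFSet → ZFSet} {a z : ZFSet} : z ∈ img f a ↔ ∃ x ∈ a, f x = z := by
  unfold img
  exact @ZFSet.mem_image f (Classical.allZFSetDefinable _) a z

theorem img_mem {f : ZFSet → ZFSet} {a x : ZFSet} (h : x ∈ a) : f x ∈ img f a :=
  mem_img.2 ⟨x, h, rfl⟩

theorem fst_mem {a x y : ZFSet} (h : pair x y ∈ a) : x ∈ img pfst a := by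
  simpa using img_mem (f := pfst) h

theorem snd_mem {a x y : ZFSet} (h : pair x y ∈ a) : y ∈ img psnd a := by
  simpa using img_mem (f := psnd) h

variable {M : Set ZFSet} (j : ElemEmb Set.univ M)

/-- Extension of `j` to classes. -/
def ElemEmb.J (X : Set ZFSet) : Set ZFSet :=
  {z | ∃ B : ZFSet, (∀ x ∈ B, x ∈ X) ∧ z ∈ j.toFun B}

variable {j}

theorem J_mono {X Y : Set ZFSet} (h : ∀ x ∈ X, x ∈ Y) {z : ZFSet} (hz : z ∈ j.J X) : z ∈ j.J Y := by
  obtain ⟨B, hB, hz⟩ := hz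
  exact ⟨B, fun x hx => h x (hB x hx), hz⟩

theorem J_univ {X : Set ZFSet} {z : ZFSet} (hz : z ∈ j.J X) : z ∈ j.J Set.univ :=
  J_mono (fun _ _ => trivial) hz

theorem J_inter (hM : TransClass M) {X Y Z : Set ZFSet} (h : ∀ x, x ∈ X → x ∈ Y → x ∈ Z)
    {z : ZFSet} (hX : z ∈ j.J X) (hY : z ∈ j.J Y) : z ∈ j.J Z := by
  obtain ⟨B, hB, hz⟩ := hX
  obtain ⟨C, hC, hz'⟩ := hY
  refine ⟨ZFSet.sep (fun x => x ∈ C) B, ?_, ?_⟩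
  · intro x hx
    rw [ZFSet.mem_sep] at hx
    exact h x (hB x hx.1) (hC x hx.2)
  · exact j.h_inter hM (fun x h1 h2 => ZFSet.mem_sep.2 ⟨h1, h2⟩) hz hz'

theorem J_disj (hM : TransClass M) {X Y : Set ZFSet} (h : ∀ x, x ∈ X → x ∈ Y → False)
    {z : ZFSet} (hX : z ∈ j.J X) (hY : z ∈ j.J Y) : False := by
  obtain ⟨B, hB, hz⟩ := hX
  obtain ⟨C, hC, hz'⟩ := hY
  exact j.h_disj hM (fun x h1 h2 => h x (hB x h1) (hC x h2)) hz hz'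

theorem J_not (hM : TransClass M) {P : ZFSet → Prop} {z : ZFSet} (hz : z ∈ j.J Set.univ) :
    z ∈ j.J {x | ¬ P x} ↔ ¬ z ∈ j.J {x | P x} := by
  constructor
  · intro h1 h2
    exact J_disj (X := {x | ¬ P x}) (Y := {x | P x}) hM (fun x hx hx' => hx hx') h1 h2
  · intro h
    obtain ⟨B, -, hz⟩ := hz
    have := j.h_cover hM (a := B) (b := ZFSet.sep P B) (c := ZFSet.sep (fun x => ¬ P x) B)
      (by intro x hx; simp only [ZFSet.mem_sep]; tauto) hz
    rcases this with h1 | h1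
    · exact (h ⟨_, fun x hx => (ZFSet.mem_sep.1 hx).2, h1⟩).elim
    · exact ⟨_, fun x hx => (ZFSet.mem_sep.1 hx).2, h1⟩

theorem J_dom (hM : TransClass M) {X : Set ZFSet} {s : ZFSet} :
    s ∈ j.J {x | ∃ y, pair x y ∈ X} ↔ ∃ y, pair s y ∈ j.J X := by
  constructor
  · rintro ⟨B, hB, hs⟩
    choose! f hf using hB
    obtain ⟨y, hy⟩ := j.h_dom2 hM (a := B) (b := img (fun x => pair x (f x)) B)
      (fun x hx => ⟨f x, img_mem (f := fun x => pair x (f x)) hx⟩) hs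
    refine ⟨y, _, ?_, hy⟩
    intro z hz
    obtain ⟨x, hx, rfl⟩ := mem_img.1 hz
    exact hf x hx
  · rintro ⟨y, B, hB, hy⟩
    refine ⟨ZFSet.sep (fun x => ∃ y, pair x y ∈ B) (img pfst B), ?_, ?_⟩
    · intro x hx
      obtain ⟨-, y, hy⟩ := ZFSet.mem_sep.1 hx
      exact ⟨y, hB _ hy⟩
    · exact j.h_dom1 hM (fun x y h => ZFSet.mem_sep.2 ⟨fst_mem h, y, h⟩) hy

/-- `y` is the value of `j g` at `s`. -/
def Val (j : ElemEmb Set.univ M) (s : ZFSet) (g : ZFSet → ZFSet) (y : ZFSet) : Prop :=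
  pair s y ∈ j.J {z | ∃ x, z = pair x (g x)}

theorem Val.univ (hM : TransClass M) {s y : ZFSet} {g : ZFSet → ZFSet} (h : Val j s g y) :
    s ∈ j.J Set.univ :=
  J_univ ((J_dom hM).2 ⟨y, h⟩)

theorem Val.exists (hM : TransClass M) {s : ZFSet} (g : ZFSet → ZFSet) (h : s ∈ j.J Set.univ) :
    ∃ y, Val j s g y := by
  have h2 : s ∈ j.J {x | ∃ y, pair x y ∈ {z | ∃ x, z = pair x (g x)}} :=
    J_mono (fun x _ => show ∃ y, pair x y ∈ {z | ∃ x, z = pair x (g x)} from ⟨g x, x, rfl⟩) h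
  exact (J_dom hM).1 h2

theorem Val.core {B x y : ZFSet} {g : ZFSet → ZFSet} (hB : ∀ z ∈ B, ∃ x, z = pair x (g x))
    (h : pair x y ∈ B) : y = g x := by
  obtain ⟨x', hx'⟩ := hB _ h
  obtain ⟨rfl, rfl⟩ := pair_inj.1 hx'
  rfl

theorem Val.mem (hM : TransClass M) {s y y' : ZFSet} {g g' : ZFSet → ZFSet} (h : Val j s g y)
    (h' : Val j s g' y') : y ∈ y' ↔ s ∈ j.J {x | g x ∈ g' x} := by
  obtain ⟨B, hB, hz⟩ := h
  obtain ⟨C, hC, hz'⟩ := h'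
  have key : ∀ D : ZFSet, (s ∈ j.toFun (ZFSet.sep (fun x => g x ∈ g' x) (img pfst B ∪ D)) ↔
      y ∈ y') := by
    intro D
    refine j.h_mem hM ?_ hz hz'
    intro x y z h1 h2
    rw [Val.core hB h1, Val.core hC h2, ZFSet.mem_sep, ZFSet.mem_union]
    exact ⟨fun h => h.2, fun h => ⟨Or.inl (fst_mem h1), h⟩⟩
  constructor
  · intro h
    exact ⟨_, fun x hx => (ZFSet.mem_sep.1 hx).2, (key ∅).2 h⟩
  · rintro ⟨D, hD, h⟩
    refine (key D).1 (j.h_mono hM ?_ h)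
    intro x hx
    exact ZFSet.mem_sep.2 ⟨ZFSet.mem_union.2 (Or.inr hx), hD x hx⟩

theorem Val.eq (hM : TransClass M) {s y y' : ZFSet} {g g' : ZFSet → ZFSet} (h : Val j s g y)
    (h' : Val j s g' y') : y = y' ↔ s ∈ j.J {x | g x = g' x} := by
  obtain ⟨B, hB, hz⟩ := h
  obtain ⟨C, hC, hz'⟩ := h'
  have key : ∀ D : ZFSet, (s ∈ j.toFun (ZFSet.sep (fun x => g x = g' x) (img pfst B ∪ D)) ↔
      y = y') := by
    intro D
    refine j.h_eq hM ?_ hz hz'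
    intro x y z h1 h2
    rw [Val.core hB h1, Val.core hC h2, ZFSet.mem_sep, ZFSet.mem_union]
    exact ⟨fun h => h.2, fun h => ⟨Or.inl (fst_mem h1), h⟩⟩
  constructor
  · intro h
    exact ⟨_, fun x hx => (ZFSet.mem_sep.1 hx).2, (key ∅).2 h⟩
  · rintro ⟨D, hD, h⟩
    refine (key D).1 (j.h_mono hM ?_ h)
    intro x hx
    exact ZFSet.mem_sep.2 ⟨ZFSet.mem_union.2 (Or.inr hx), hD x hx⟩

theorem Val.unique (hM : TransClass M) {s y y' : ZFSet} {g : ZFSet → ZFSet} (h : Val j s g y)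
    (h' : Val j s g y') : y = y' :=
  (h.eq hM h').2 (J_mono (fun _ _ => rfl) (h.univ hM))

theorem Val.fst (hM : TransClass M) {s t y : ZFSet} {g : ZFSet → ZFSet} (h : Val j s g y)
    (ht : pair s t ∈ j.J Set.univ) : Val j (pair s t) (fun z => g (pfst z)) y := by
  obtain ⟨B, hB, hz⟩ := h
  obtain ⟨D, -, hD⟩ := ht
  refine ⟨img (fun z => pair z (g (pfst z))) D, ?_, ?_⟩
  · intro z hz
    obtain ⟨x, -, rfl⟩ := mem_img.1 hz
    exact ⟨x, rfl⟩
  · refine j.h_fst hM ?_ hz hD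
    intro x y z h1 h2
    rw [Val.core hB h1]
    simpa using img_mem (f := fun z => pair z (g (pfst z))) h2

theorem Val.snd (hM : TransClass M) {s t : ZFSet}
    (ht : pair s t ∈ j.J Set.univ) : Val j (pair s t) psnd t := by
  obtain ⟨D, -, hD⟩ := ht
  refine ⟨img (fun z => pair z (psnd z)) D, ?_, ?_⟩
  · intro z hz
    obtain ⟨x, -, rfl⟩ := mem_img.1 hz
    exact ⟨x, rfl⟩
  · refine j.h_snd hM ?_ hD
    intro x y h1
    simpa using img_mem (f := fun z => pair z (psnd z)) h1

theorem Val.const (hM : TransClass M) {s : ZFSet} (x : ZFSet) (hs : s ∈ j.J Set.univ) :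
    Val j s (fun _ => x) (j.toFun x) := by
  obtain ⟨D, -, hD⟩ := hs
  refine ⟨img (fun z => pair z x) D, ?_, ?_⟩
  · intro z hz
    obtain ⟨y, -, rfl⟩ := mem_img.1 hz
    exact ⟨y, rfl⟩
  · refine j.h_prod hM (a := D) (b := {x}) ?_ hD (j.map_mem.1 (ZFSet.mem_singleton.2 rfl))
    intro z hz y hy
    rw [ZFSet.mem_singleton.1 hy]
    exact img_mem (f := fun z => pair z x) hz

theorem Val.id (hM : TransClass M) {s : ZFSet} (hs : s ∈ j.J Set.univ) :
    Val j s (fun x => x) s := by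
  obtain ⟨D, -, hD⟩ := hs
  refine ⟨img (fun z => pair z z) D, ?_, ?_⟩
  · intro z hz
    obtain ⟨y, -, rfl⟩ := mem_img.1 hz
    exact ⟨y, rfl⟩
  · exact j.h_diag hM (fun x hx => img_mem (f := fun z => pair z z) hx) hD

theorem Val.pre (hM : TransClass M) {s m y : ZFSet} {p : ZFSet → ZFSet} (h : Val j s p m)
    (Y : Set ZFSet) :
    pair m y ∈ j.J Y ↔ pair s y ∈ j.J {z | ∃ x u, z = pair x u ∧ pair (p x) u ∈ Y} := by
  obtain ⟨B, hB, hz⟩ := h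
  constructor
  · rintro ⟨D, hD, hy⟩
    refine ⟨ZFSet.sep (fun z => ∃ x u, z = pair x u ∧ pair (p x) u ∈ Y)
      (ZFSet.prod (img pfst B) (img psnd D)), fun z hz => (ZFSet.mem_sep.1 hz).2, ?_⟩
    refine j.h_pre1 hM ?_ hz hy
    intro x m y h1 h2
    have e := Val.core hB h1
    exact ZFSet.mem_sep.2 ⟨pair_mem_prod.2 ⟨fst_mem h1, snd_mem h2⟩, x, y, rfl, e ▸ hD _ h2⟩
  · rintro ⟨D, hD, hy⟩
    refine ⟨ZFSet.sep (fun z => z ∈ Y)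
      (ZFSet.prod (img psnd B) (img psnd D)), fun z hz => (ZFSet.mem_sep.1 hz).2, ?_⟩
    refine j.h_pre2 hM ?_ hz hy
    intro x m y h1 h2
    have e := Val.core hB h1
    obtain ⟨x', u', e1, e2⟩ := hD _ h2
    obtain ⟨rfl, rfl⟩ := pair_inj.1 e1
    exact ZFSet.mem_sep.2 ⟨pair_mem_prod.2 ⟨snd_mem h1, snd_mem h2⟩, e ▸ e2⟩

/-- The class of pairs coding a family of classes. -/
def Fam (N : ZFSet → Set ZFSet) : Set ZFSet := {z | ∃ α x, z = pair α x ∧ x ∈ N α}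

theorem pair_mem_Fam {N : ZFSet → Set ZFSet} {α x : ZFSet} : pair α x ∈ Fam N ↔ x ∈ N α := by
  constructor
  · rintro ⟨α', x', e, h⟩
    obtain ⟨rfl, rfl⟩ := pair_inj.1 e
    exact h
  · intro h
    exact ⟨α, x, rfl, h⟩

/-- The member at index `m` of the image of a family of classes under `j`. -/
def JFam (j : ElemEmb Set.univ M) (N : ZFSet → Set ZFSet) (m : ZFSet) : Set ZFSet :=
  {y | pair m y ∈ j.J (Fam N)}

theorem los (hM : TransClass M) (N : ZFSet → Set ZFSet) (m : ZFSet) {n : ℕ} (φ : Fml n) :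
    ∀ (s : ZFSet) (p : ZFSet → ZFSet) (g : Fin n → ZFSet → ZFSet) (y : Fin n → ZFSet),
      Val j s p m → (∀ k, Val j s (g k) (y k)) →
      (Realize (JFam j N m) φ y ↔ s ∈ j.J {x | Realize (N (p x)) φ (fun k => g k x)}) := by
  induction φ with
  | mem a b =>
    intro s p g y hp hg
    simp only [realize_mem]
    exact (hg a).mem hM (hg b)
  | eq a b =>
    intro s p g y hp hg
    simp only [realize_eq]
    exact (hg a).eq hM (hg b)
  | not φ ih =>
    intro s p g y hp hg
    simp only [realize_not]
    rw [J_not hM (hp.univ hM), ih s p g y hp hg]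
  | and φ ψ ih1 ih2 =>
    intro s p g y hp hg
    simp only [realize_and]
    rw [ih1 s p g y hp hg, ih2 s p g y hp hg]
    constructor
    · rintro ⟨h1, h2⟩
      exact J_inter hM (fun x hx hx' => show x ∈ {x | _ ∧ _} from ⟨hx, hx'⟩) h1 h2
    · intro h
      exact ⟨J_mono (fun x hx => hx.1) h, J_mono (fun x hx => hx.2) h⟩
  | @ex n φ ih =>
    intro s p g y hp hg
    simp only [realize_ex]
    have e : {x | ∃ u ∈ N (p x), Realize (N (p x)) φ (Fin.snoc (fun k => g k x) u)} =
        {x | ∃ u, pair x u ∈ {z | (∃ x u, z = pair x u) ∧ psnd z ∈ N (p (pfst z)) ∧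
          Realize (N (p (pfst z))) φ (Fin.snoc (fun k => g k (pfst z)) (psnd z))}} := by
      ext x
      simp only [Set.mem_ofPred_eq, pfst_pair, psnd_pair]
      exact exists_congr fun u => ⟨fun h => ⟨⟨x, u, rfl⟩, h⟩, fun h => h.2⟩
    rw [e, J_dom hM]
    refine exists_congr fun u => ?_
    have hN : u ∈ JFam j N m ↔ pair s u ∈ j.J {z | ∃ x u, z = pair x u ∧ pair (p x) u ∈ Fam N} :=
      hp.pre hM (Fam N)
    have key : pair s u ∈ j.J Set.univ →
        (Realize (JFam j N m) φ (Fin.snoc y u) ↔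
          pair s u ∈ j.J {z | Realize (N (p (pfst z))) φ
            (Fin.snoc (fun k => g k (pfst z)) (psnd z))}) := by
      intro hsu
      rw [ih (pair s u) (fun z => p (pfst z))
        (Fin.snoc (α := fun _ => ZFSet → ZFSet) (fun k z => g k (pfst z)) psnd) (Fin.snoc y u)
        (hp.fst hM hsu) ?_]
      · have : ∀ z, (fun k => (Fin.snoc (α := fun _ => ZFSet → ZFSet)
            (fun k z => g k (pfst z)) psnd : Fin (n + 1) → ZFSet → ZFSet) k z) =
            Fin.snoc (α := fun _ => ZFSet) (fun k => g k (pfst z)) (psnd z) := by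
          intro z
          funext k
          refine Fin.lastCases ?_ (fun k => ?_) k <;> simp
        simp only [this]
      · intro k
        refine Fin.lastCases ?_ (fun k => ?_) k
        · simpa using Val.snd hM hsu
        · simpa using (hg k).fst hM hsu
    constructor
    · rintro ⟨h1, h2⟩
      have h1' := hN.1 h1
      refine J_inter hM ?_ h1' ((key (J_univ h1')).1 h2)
      rintro z ⟨x, u, rfl, h⟩ h'
      refine ⟨⟨x, u, rfl⟩, ?_, h'⟩
      simpa using pair_mem_Fam.1 h
    · intro h
      refine ⟨hN.2 ?_, (key (J_univ h)).2 (J_mono (fun z hz => hz.2.2) h)⟩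
      refine J_mono ?_ h
      rintro z ⟨⟨x, u, rfl⟩, h1, h2⟩
      refine ⟨x, u, rfl, pair_mem_Fam.2 ?_⟩
      simpa using h1


/-- The identity embedding. -/
def idEmb : ElemEmb Set.univ Set.univ where
  toFun x := x
  maps _ _ := trivial
  elem _ _ _ := Iff.rfl

theorem strong_family {κ lam A : ZFSet} (hlt : LtStrongForIn Set.univ κ lam A) (α : ZFSet) :
    ∃ (N : Set ZFSet) (i : ElemEmb Set.univ N), TransClass N ∧
      (α ∈ lam → VInclIn Set.univ N α ∧ AgreeBelowIn Set.univ α A (i.toFun A)) ∧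
      (oLe κ α → α ∈ lam → α ∈ i.toFun κ) ∧ ∀ β ∈ κ, i.toFun β = β := by
  by_cases h : oLe κ α ∧ α ∈ lam
  · obtain ⟨N, -, hN, i, hc, h1, h2, h3⟩ := hlt α h.1 h.2
    exact ⟨N, i, hN, fun _ => ⟨h2, h3⟩, fun _ _ => h1, hc.2.2⟩
  · exact ⟨Set.univ, idEmb, transClass_univ, fun _ => ⟨fun _ _ _ => trivial, fun _ _ _ => Iff.rfl⟩,
      fun h1 h2 => (h ⟨h1, h2⟩).elim, fun _ _ => rfl⟩

theorem isOrdinal_of_isOrd {x : ZFSet} (h : IsOrd x) : x.IsOrdinal :=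
  isOrdinal_iff_forall_mem_isTransitive.2 ⟨h.1, h.2⟩

theorem oLe_of_not_mem {κ lam α : ZFSet} (hκ : IsOrd κ) (hlam : IsOrd lam) (hα : α ∈ lam)
    (h : α ∉ κ) : oLe κ α := by
  have h1 := isOrdinal_of_isOrd hκ
  have h2 := (isOrdinal_of_isOrd hlam).mem hα
  rcases h1.mem_trichotomous h2 with h3 | h3 | h3
  · exact Or.inl h3
  · exact Or.inr h3
  · exact (h h3).elim

/-- The set of pairs `(α, x)` with `α ∈ l` and `x ∈ V_α`. -/
noncomputable def rankRel (l : ZFSet) : ZFSet :=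
  ZFSet.sep (fun z => (psnd z).rank < (pfst z).rank) (ZFSet.prod l (V_ l.rank))

theorem pair_mem_rankRel {l α x : ZFSet} : pair α x ∈ rankRel l ↔ α ∈ l ∧ x.rank < α.rank := by
  simp only [rankRel, ZFSet.mem_sep, pair_mem_prod, pfst_pair, psnd_pair, mem_vonNeumann]
  constructor
  · rintro ⟨⟨h1, h2⟩, h3⟩
    exact ⟨h1, h3⟩
  · rintro ⟨h1, h2⟩
    exact ⟨⟨h1, h2.trans (rank_lt_of_mem h1)⟩, h2⟩

theorem of_mem_rankRel {l z : ZFSet} (h : z ∈ rankRel l) :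
    ∃ α x, z = pair α x ∧ α ∈ l ∧ x.rank < α.rank := by
  have h' := h
  rw [rankRel, ZFSet.mem_sep, mem_prod] at h
  obtain ⟨⟨α, _, x, _, rfl⟩, -⟩ := h
  exact ⟨α, x, rfl, pair_mem_rankRel.1 h'⟩

theorem map_rankRel (hM : TransClass M) {l : ZFSet} (hl : l.IsTransitive) :
    ∀ α ∈ j.toFun l, ∀ x ∈ M, pair α x ∈ j.toFun (rankRel l) ↔ x.rank < α.rank := by
  intro α
  induction α using ZFSet.inductionOn with
  | _ α ih =>
    intro hα x hx
    rw [j.h_rank hM (l := l) (b := rankRel l) ?_ hα hx, lt_rank_iff]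
    · refine exists_congr fun β => and_congr_right fun hβ => ?_
      rw [rank_le_iff]
      have hβl := j.h_trans hM (fun x hx y hy => hl x hx hy) hα hβ
      exact forall_congr' fun y => imp_congr_right fun hy => ih β hβ hβl y (hM _ hx _ hy)
    · intro α hα x
      rw [pair_mem_rankRel, lt_rank_iff, and_iff_right hα]
      refine exists_congr fun β => and_congr_right fun hβ => ?_
      rw [rank_le_iff]
      have hβl : β ∈ l := hl α hα hβ
      exact forall_congr' fun y => imp_congr_right fun hy => by
        rw [pair_mem_rankRel, and_iff_right hβl]

theorem strong_for_coheres {κ lam μ A : ZFSet} (hκ : IsOrd κ) (hlam : IsOrd lam) (hμ : IsOrd μ)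
    (hκlam : κ ∈ lam) (hlamμ : lam ∈ μ) (hlt : LtStrongForIn Set.univ κ lam A)
    (h : LamStrongForIn Set.univ lam μ A) : LamStrongForIn Set.univ κ μ A := by
  obtain ⟨M, -, hM, j, ⟨-, -, hfix⟩, hμj, hV, hA⟩ := h
  choose N i hN hi1 hi2 hi3 using strong_family hlt
  have hκμ : κ ∈ μ := hμ.1 lam hlamμ hκlam
  have hμκ : μ ∉ κ := fun h' => mem_asymm hκμ h'
  have hμU : μ ∈ j.J Set.univ := ⟨lam, fun _ _ => trivial, hμj⟩
  have hid := Val.id hM hμU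
  choose e he using fun x => Val.exists hM (fun α => (i α).toFun x) hμU
  have hrel : ∀ x, x.rank < μ.rank → pair μ x ∈ j.toFun (rankRel lam) := fun x hx =>
    (map_rankRel hM hlam.1 μ hμj x (hV x trivial hx)).2 hx
  have hμe : μ ∈ e κ := by
    rw [hid.mem hM (he κ)]
    have h1 := j.h_cover hM (a := lam) (b := κ) (c := ZFSet.sep (fun x => x ∉ κ) lam)
      (by intro x hx; simp only [ZFSet.mem_sep]; tauto) hμj
    rw [hfix κ hκlam] at h1
    refine ⟨_, ?_, h1.resolve_left hμκ⟩
    intro α hα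
    rw [ZFSet.mem_sep] at hα
    exact hi2 α (oLe_of_not_mem hκ hlam hα.1 hα.2) hα.1
  have hmaps : ∀ x, e x ∈ JFam j N μ := by
    intro x
    refine J_mono ?_ (he x)
    rintro z ⟨α, rfl⟩
    exact pair_mem_Fam.2 ((i α).mem_M x)
  have helem : ∀ {n : ℕ} (φ : Fml n) (v : Fin n → ZFSet),
      (Realize Set.univ φ v ↔ Realize (JFam j N μ) φ (fun k => e (v k))) := by
    intro n φ v
    rw [los hM N μ φ μ (fun x => x) (fun k α => (i α).toFun (v k)) _ hid (fun k => he (v k))]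
    have h1 : ∀ α, Realize (N α) φ (fun k => (i α).toFun (v k)) ↔ Realize Set.univ φ v :=
      fun α => ((i α).elem φ v (fun _ => trivial)).symm
    simp only [h1]
    constructor
    · intro h2
      exact J_mono (fun _ _ => h2) hμU
    · intro h2
      by_contra h3
      exact J_disj hM (fun x hx _ => h3 hx) h2 h2
  refine ⟨JFam j N μ, fun _ _ => trivial, ?_, ⟨e, fun x _ => hmaps x, fun φ v _ => helem φ v⟩,
    ⟨hκ, ?_, ?_⟩, hμe, ?_, ?_⟩
  · rintro y ⟨D, hD, hy⟩ z hz
    refine ⟨ZFSet.sep (fun w => w ∈ Fam N) (ZFSet.prod (img pfst D) (⋃₀ (img psnd D))),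
      fun w hw => (ZFSet.mem_sep.1 hw).2, j.h_tr hM ?_ hy hz⟩
    intro x y h1 z hz
    refine ZFSet.mem_sep.2 ⟨pair_mem_prod.2 ⟨fst_mem h1, mem_sUnion.2 ⟨y, snd_mem h1, hz⟩⟩, ?_⟩
    exact pair_mem_Fam.2 (hN x y (pair_mem_Fam.1 (hD _ h1)) z hz)
  · intro h1
    change e κ = κ at h1
    rw [h1] at hμe
    exact hμκ hμe
  · intro β hβ
    change e β = β
    have h1 := he β
    have h2 : (fun α => (i α).toFun β) = fun _ => β := funext fun α => hi3 α β hβ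
    rw [h2] at h1
    rw [h1.unique hM (Val.const hM β hμU)]
    exact hfix β (hlam.1 κ hκlam hβ)
  · intro x _ hx
    refine ⟨rankRel lam, ?_, hrel x hx⟩
    intro z hz
    obtain ⟨α, x, rfl, h1, h2⟩ := of_mem_rankRel hz
    exact pair_mem_Fam.2 ((hi1 α h1).1 x trivial h2)
  · intro x _ hx
    change x ∈ A ↔ x ∈ e A
    rw [hA x trivial hx]
    have hs : pair μ x ∈ j.J {z | z ∈ rankRel lam} := ⟨_, fun _ h => h, hrel x hx⟩
    have hsU := J_univ hs
    have hsnd := Val.snd hM hsU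
    rw [hsnd.mem hM (Val.const hM A hsU), hsnd.mem hM ((he A).fst hM hsU)]
    have key : ∀ z ∈ rankRel lam, (psnd z ∈ A ↔ psnd z ∈ (i (pfst z)).toFun A) := by
      intro z hz
      obtain ⟨α, x, rfl, h1, h2⟩ := of_mem_rankRel hz
      rw [psnd_pair, pfst_pair]
      exact (hi1 α h1).2 x trivial h2
    constructor
    · intro h1
      exact J_inter hM (fun z h2 h3 => (key z h2).1 h3) hs h1
    · intro h1
      exact J_inter hM (fun z h2 h3 => (key z h2).2 h3) hs h1

theorem strongFor_empty {κ lam : ZFSet} :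
    LamStrongForIn Set.univ κ lam ∅ ↔ LamStrongIn Set.univ κ lam := by
  constructor
  · rintro ⟨M, h1, h2, j, h3, h4, h5, -⟩
    exact ⟨M, h1, h2, j, h3, h4, h5⟩
  · rintro ⟨M, h1, h2, j, h3, h4, h5⟩
    refine ⟨M, h1, h2, j, h3, h4, h5, ?_⟩
    intro x _ _
    rw [j.h_empty h2]

end Main

/-- **Proposition (strongness coheres).**  Suppose `κ ≤ lam < μ` are cardinals,
`κ` is `<lam`-strong and `lam` is `μ`-strong; then `κ` is `μ`-strong.
Moreover, if `κ` is `<lam`-strong for `A` and `lam` is `μ`-strong for `A`,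
then `κ` is `μ`-strong for `A`. -/
theorem strongness_coheres (κ lam μ A : ZFSet)
    (hκ : IsCard κ) (hlam : IsCard lam) (hμ : IsCard μ)
    (hκlam : oLe κ lam) (hlamμ : lam ∈ μ) :
    (LtStrong κ lam → LamStrong lam μ → LamStrong κ μ) ∧
    (LtStrongFor κ lam A → LamStrongFor lam μ A → LamStrongFor κ μ A) := by
  have main : ∀ B : ZFSet, LtStrongForIn Set.univ κ lam B → LamStrongForIn Set.univ lam μ B →
      LamStrongForIn Set.univ κ μ B := by
    intro B h1 h2
    rcases hκlam with h | h
    · exact strong_for_coheres hκ.1 hlam.1 hμ.1 h hlamμ h1 h2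
    · rw [h]
      exact h2
  refine ⟨fun h1 h2 => ?_, main A⟩
  exact strongFor_empty.1 (main ∅ (fun α h3 h4 => strongFor_empty.2 (h1 α h3 h4))
    (strongFor_empty.2 h2))

end WSC
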